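/- For integers k ≥ i ≥ 1 and complex q with 0 < |q| < 1, Σ_{n≥0} Ē_{k,i}(n,0) q^n = (q^i, q^{2k+1−i}, q^{2k+1}; q^{2k+1})_∞ / (q;q)_∞; that is, the generating function for paths with no South steps satisfying the special (k,i)-conditions equals the displayed infinite product divided by (q;q)_∞. -/

import Mathlib

namespace Paper

/-- The four kinds of unitary steps. -/
inductive PStep : Type
  | NE | SE | S | E
  deriving DecidableEq, BEq, Repr

/-- Horizontal displacement of a step. -/
def stepDx : PStep → ℕ
  | .S => 0
  | _ => 1

/-- Vertical displacement of a step. -/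
def stepDy : PStep → ℤ
  | .NE => 1
  | .SE => -1
  | .S => -1
  | .E => 0

/-- Height (`y`-coordinate) after performing the steps of `l`, starting at height `h`. -/
def pathHeight (h : ℕ) (l : List PStep) : ℤ := (h : ℤ) + (l.map stepDy).sum

/-- `x`-coordinate after performing the steps of `l`, starting on the `y`-axis. -/
def pathX (l : List PStep) : ℕ := (l.map stepDx).sum

/-- A valid path: stays in the first quadrant, starts at `(0,h)` on the `y`-axis, ends
on the `x`-axis, South steps only appear directly after a North-East step, East steps
only appear at height `0`, and the path is empty or ends with a South-East or South step. -/
def ValidPath (h : ℕ) (l : List PStep) : Prop :=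
  (∀ m : ℕ, 0 ≤ pathHeight h (l.take m)) ∧
  (∀ m : ℕ, l[m]? = some PStep.S → ∃ m', m = m' + 1 ∧ l[m']? = some PStep.NE) ∧
  (∀ m : ℕ, l[m]? = some PStep.E → pathHeight h (l.take m) = 0) ∧
  pathHeight h l = 0 ∧
  (l = [] ∨ l.getLast? = some PStep.SE ∨ l.getLast? = some PStep.S)

/-- The vertex reached after step `m` is a peak: it is preceded by a North-East step and
followed by a South-East step (NESE peak) or a South step (NES peak). -/
def IsPeak (l : List PStep) (m : ℕ) : Prop :=
  l[m]? = some PStep.NE ∧ (l[m+1]? = some PStep.SE ∨ l[m+1]? = some PStep.S)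

instance (l : List PStep) (m : ℕ) : Decidable (IsPeak l m) := by
  unfold IsPeak; infer_instance

/-- The major index of a path: the sum of the `x`-coordinates of its peaks. -/
def majorIndex (l : List PStep) : ℕ :=
  ∑ m ∈ Finset.range l.length, if IsPeak l m then pathX (l.take (m + 1)) else 0

/-- The number of peaks of a path. -/
def numPeaks (l : List PStep) : ℕ :=
  ((Finset.range l.length).filter fun m => IsPeak l m).card

/-- The number of South steps of a path. -/
def southSteps (l : List PStep) : ℕ := l.count PStep.S

/-- A path satisfies the special `(k,i)`-conditions if it is a valid path starting at
height `k - i` whose height always stays below `k`. -/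
def SpecialPath (k i : ℕ) (l : List PStep) : Prop :=
  ValidPath (k - i) l ∧ ∀ m : ℕ, pathHeight (k - i) (l.take m) < k

/-- `Ebar k i n j` is the number of paths with major index `n` and `j` South steps
satisfying the special `(k,i)`-conditions. -/
noncomputable def Ebar (k i n j : ℕ) : ℕ :=
  Nat.card {l : List PStep // SpecialPath k i l ∧ majorIndex l = n ∧ southSteps l = j}

open scoped Classical

/-- The infinite q-Pochhammer symbol `(x;q)_∞ = ∏_{i≥0} (1 - x qⁱ)`. -/
noncomputable def qPochInf (x q : ℂ) : ℂ := ∏' i : ℕ, (1 - x * q ^ i)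

/-- The finite q-Pochhammer symbol `(x;q)_N = ∏_{i=0}^{N-1} (1 - x qⁱ)`. -/
noncomputable def qPochN (x q : ℂ) (N : ℕ) : ℂ := ∏ i ∈ Finset.range N, (1 - x * q ^ i)

/-- The q-Pochhammer symbol with arbitrary integer index,
`(x;q)_n = (x;q)_∞ / (x qⁿ;q)_∞`. -/
noncomputable def qPochZ (x q : ℂ) (n : ℤ) : ℂ := qPochInf x q / qPochInf (x * q ^ n) q

open Filter Topology

/-- The reciprocal `1 / (q;q)_m`, extended by zero to negative `m`. -/
noncomputable def qInv (q : ℂ) (m : ℤ) : ℂ := if 0 ≤ m then (qPochN q q m.toNat)⁻¹ else 0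

lemma summable_neg_mul_pow (x : ℂ) {q : ℂ} (hq : ‖q‖ < 1) :
    Summable fun n : ℕ => ‖-(x * q ^ n)‖ := by
  simp only [norm_neg, norm_mul, norm_pow]
  exact (summable_geometric_of_lt_one (norm_nonneg q) hq).mul_left _

lemma tendsto_qPochN (x : ℂ) {q : ℂ} (hq : ‖q‖ < 1) :
    Tendsto (qPochN x q) atTop (𝓝 (qPochInf x q)) := by
  have h := (multipliable_one_add_of_summable (summable_neg_mul_pow x hq)).hasProd.tendsto_prod_nat
  simp only [← sub_eq_add_neg] at h
  exact h

lemma one_sub_mul_pow_ne_zero {q : ℂ} (hq : ‖q‖ < 1) (n : ℕ) : 1 - q * q ^ n ≠ 0 := by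
  intro h
  have h1 : ‖q ^ (n + 1)‖ = 1 := by
    rw [pow_succ', ← sub_eq_zero.mp h, norm_one]
  rw [norm_pow] at h1
  exact absurd h1 (pow_lt_one₀ (norm_nonneg q) hq (Nat.succ_ne_zero n)).ne

lemma qPochInf_ne_zero {q : ℂ} (hq : ‖q‖ < 1) : qPochInf q q ≠ 0 := by
  have h := tprod_one_add_ne_zero_of_summable (f := fun n : ℕ => -(q * q ^ n))
    (fun n => by simpa only [← sub_eq_add_neg] using one_sub_mul_pow_ne_zero hq n)
    (summable_neg_mul_pow q hq)
  simp only [← sub_eq_add_neg] at h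
  exact h

lemma qPochN_ne_zero {q : ℂ} (hq : ‖q‖ < 1) (n : ℕ) : qPochN q q n ≠ 0 :=
  Finset.prod_ne_zero_iff.mpr fun i _ => one_sub_mul_pow_ne_zero hq i

lemma qPochN_succ (x q : ℂ) (n : ℕ) : qPochN x q (n + 1) = qPochN x q n * (1 - x * q ^ n) :=
  Finset.prod_range_succ _ _

lemma qInv_natCast (q : ℂ) (n : ℕ) : qInv q n = (qPochN q q n)⁻¹ := by simp [qInv]

lemma qInv_of_neg (q : ℂ) {m : ℤ} (hm : m < 0) : qInv q m = 0 := by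
  simp [qInv, not_le.mpr hm]

lemma one_sub_zpow_mul_qInv {q : ℂ} (hq : ‖q‖ < 1) (m : ℤ) :
    (1 - q ^ m) * qInv q m = qInv q (m - 1) := by
  rcases lt_trichotomy m 0 with hm | rfl | hm
  · rw [qInv_of_neg q hm, qInv_of_neg q (by lia), mul_zero]
  · simp [qInv]
  · obtain ⟨n, rfl⟩ : ∃ n : ℕ, m = (n + 1 : ℕ) := ⟨(m - 1).toNat, by lia⟩
    rw [show ((n + 1 : ℕ) : ℤ) - 1 = n by push_cast; ring, qInv_natCast, qInv_natCast, qPochN_succ,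
      zpow_natCast, pow_succ']
    have := one_sub_mul_pow_ne_zero hq n
    have := qPochN_ne_zero hq n
    field_simp

lemma tendsto_qInv {q : ℂ} (hq : ‖q‖ < 1) :
    Tendsto (qInv q) atTop (𝓝 (qPochInf q q)⁻¹) := by
  have h : Tendsto (fun m : ℤ => (qPochN q q m.toNat)⁻¹) atTop (𝓝 (qPochInf q q)⁻¹) :=
    ((tendsto_qPochN q hq).comp (g := qPochN q q) (f := Int.toNat)
      (tendsto_atTop_atTop.mpr fun b => ⟨b, fun a ha => by lia⟩)).inv₀ (qPochInf_ne_zero hq)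
  refine h.congr' ?_
  filter_upwards [eventually_ge_atTop 0] with m hm
  simp [qInv, hm]

lemma exists_norm_qInv_le {q : ℂ} (hq : ‖q‖ < 1) : ∃ C : ℝ, ∀ m : ℤ, ‖qInv q m‖ ≤ C := by
  obtain ⟨C, hC⟩ := (Metric.isBounded_range_of_tendsto _
    (((tendsto_qPochN q hq).inv₀ (qPochInf_ne_zero hq)))).exists_norm_le
  refine ⟨max C 0, fun m => ?_⟩
  by_cases hm : 0 ≤ m
  · rw [qInv, if_pos hm]
    exact le_max_of_le_left (hC _ ⟨_, rfl⟩)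
  · simp [qInv, hm]

/-- The triangular number `n (n - 1) / 2`. -/
def tri (n : ℤ) : ℤ := n * (n - 1) / 2

lemma two_mul_tri (n : ℤ) : 2 * tri n = n * (n - 1) :=
  Int.mul_ediv_cancel' (by simpa [mul_comm] using (Int.even_mul_pred_self n).two_dvd)

lemma tri_add_one (n : ℤ) : tri (n + 1) = tri n + n := by
  have h1 := two_mul_tri n
  have h2 := two_mul_tri (n + 1)
  linarith

lemma tri_neg (n : ℤ) : tri (-n) = tri n + n := by
  have h1 := two_mul_tri n
  have h2 := two_mul_tri (-n)
  linarith

/-- The general term `(-1)^n z^n q^(n(n-1)/2)` of the theta series. -/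
noncomputable def thetaTerm (q z : ℂ) (n : ℤ) : ℂ := (-1) ^ n * z ^ n * q ^ tri n

lemma thetaTerm_add_one {q z : ℂ} (hq : q ≠ 0) (hz : z ≠ 0) (n : ℤ) :
    thetaTerm q z (n + 1) = -(z * q ^ n) * thetaTerm q z n := by
  rw [thetaTerm, thetaTerm, tri_add_one, zpow_add₀ hq, zpow_add_one₀ hz,
    zpow_add_one₀ (by norm_num : (-1 : ℂ) ≠ 0)]
  ring

lemma thetaTerm_neg {q z : ℂ} (hq : q ≠ 0) (n : ℤ) :
    thetaTerm q z (-n) = thetaTerm q (q / z) n := by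
  rw [thetaTerm, thetaTerm, tri_neg, zpow_add₀ hq, div_zpow, zpow_neg, zpow_neg, ← inv_zpow,
    show ((-1 : ℂ))⁻¹ = -1 by norm_num]
  ring

lemma summable_thetaTerm_nat {q z : ℂ} (hq0 : q ≠ 0) (hq : ‖q‖ < 1) (hz : z ≠ 0) :
    Summable fun n : ℕ => thetaTerm q z n := by
  have hne : ∀ n : ℤ, thetaTerm q z n ≠ 0 := fun n => by
    simp [thetaTerm, zpow_ne_zero, hq0, hz]
  refine summable_of_ratio_test_tendsto_lt_one (l := 0) one_pos
    (Eventually.of_forall fun n => hne n) ?_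
  have h : Tendsto (fun n : ℕ => ‖z‖ * ‖q‖ ^ n) atTop (𝓝 0) := by
    simpa using (tendsto_pow_atTop_nhds_zero_of_lt_one (norm_nonneg q) hq).const_mul ‖z‖
  refine h.congr fun n => ?_
  rw [Nat.cast_succ, thetaTerm_add_one hq0 hz, norm_mul, mul_div_assoc,
    div_self (norm_ne_zero_iff.mpr (hne n))]
  simp

lemma summable_thetaTerm {q z : ℂ} (hq0 : q ≠ 0) (hq : ‖q‖ < 1) (hz : z ≠ 0) :
    Summable fun n : ℤ => thetaTerm q z n := by
  refine Summable.of_nat_of_neg (summable_thetaTerm_nat hq0 hq hz) ?_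
  simp only [thetaTerm_neg hq0]
  exact summable_thetaTerm_nat hq0 hq (div_ne_zero hq0 hz)

lemma summable_mul_qInv (q : ℂ) (f : ℤ → ℂ) (a b : ℤ) :
    Summable fun n : ℤ => f n * (qInv q (a - n) * qInv q (b + n)) := by
  refine summable_of_hasFiniteSupport ((Set.finite_Icc (-b) a).subset fun n hn => ?_)
  by_contra hmem
  rw [Set.mem_Icc, not_and_or] at hmem
  rcases hmem with h | h
  · exact hn (by simp [qInv_of_neg q (show b + n < 0 by lia)])
  · exact hn (by simp [qInv_of_neg q (show a - n < 0 by lia)])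

/-- The finite theta series that interpolates the Jacobi triple product. -/
noncomputable def finTheta (q z : ℂ) (a b : ℤ) : ℂ :=
  ∑' n : ℤ, thetaTerm q z n * (qInv q (a - n) * qInv q (b + n))

lemma finTheta_left {q z : ℂ} (hq0 : q ≠ 0) (hq : ‖q‖ < 1) (hz : z ≠ 0) (a b : ℤ) :
    (1 - q ^ (a + b + 1)) * finTheta q z (a + 1) b = (1 - z * q ^ a) * finTheta q z a b := by
  have hsplit : ∀ n : ℤ, (1 - q ^ (a + b + 1)) *
      (thetaTerm q z n * (qInv q (a + 1 - n) * qInv q (b + n))) =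
      thetaTerm q z n * (qInv q (a - n) * qInv q (b + n)) +
      (thetaTerm q z n * q ^ (a + 1 - n)) * (qInv q (a + 1 - n) * qInv q (b - 1 + n)) := by
    intro n
    rw [show a - n = a + 1 - n - 1 by ring, show b - 1 + n = b + n - 1 by ring,
      ← one_sub_zpow_mul_qInv hq (a + 1 - n), ← one_sub_zpow_mul_qInv hq (b + n),
      show a + b + 1 = (a + 1 - n) + (b + n) by ring, zpow_add₀ hq0]
    ring
  have hshift : ∑' n : ℤ, (thetaTerm q z n * q ^ (a + 1 - n)) *
      (qInv q (a + 1 - n) * qInv q (b - 1 + n)) = -(z * q ^ a) * finTheta q z a b := by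
    rw [← (Equiv.addRight (1 : ℤ)).tsum_eq, finTheta, ← tsum_mul_left]
    refine tsum_congr fun n => ?_
    rw [Equiv.coe_addRight, thetaTerm_add_one hq0 hz, show a + 1 - (n + 1) = a - n by ring,
      show b - 1 + (n + 1) = b + n by ring]
    have : q ^ n * q ^ (a - n) = q ^ a := by rw [← zpow_add₀ hq0]; congr 1; ring
    linear_combination (-z * thetaTerm q z n * (qInv q (a - n) * qInv q (b + n))) * this
  rw [finTheta, ← tsum_mul_left, tsum_congr hsplit,
    (summable_mul_qInv q _ a b).tsum_add (summable_mul_qInv q _ (a + 1) (b - 1)), hshift, finTheta]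
  ring

lemma finTheta_right {q z : ℂ} (hq0 : q ≠ 0) (hq : ‖q‖ < 1) (hz : z ≠ 0) (a b : ℤ) :
    (1 - q ^ (a + b + 1)) * finTheta q z a (b + 1) = (1 - q / z * q ^ b) * finTheta q z a b := by
  have hneg : ∀ a b : ℤ, finTheta q z a b = finTheta q (q / z) b a := by
    intro a b
    rw [finTheta, ← (Equiv.neg ℤ).tsum_eq, finTheta]
    refine tsum_congr fun n => ?_
    rw [Equiv.neg_apply, thetaTerm_neg hq0, sub_neg_eq_add, ← sub_eq_add_neg,
      mul_comm (qInv q (a + n))]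
  rw [hneg, hneg, add_comm a b]
  exact finTheta_left hq0 hq (div_ne_zero hq0 hz) b a

lemma finTheta_zero (q z : ℂ) : finTheta q z 0 0 = 1 := by
  rw [finTheta, tsum_eq_single 0]
  · simp [thetaTerm, tri, qInv, qPochN]
  · intro n hn
    rcases lt_or_gt_of_ne hn with h | h
    · rw [qInv_of_neg q (show 0 + n < 0 by lia), mul_zero, mul_zero]
    · rw [qInv_of_neg q (show 0 - n < 0 by lia), zero_mul, mul_zero]

lemma qPochN_mul_finTheta {q z : ℂ} (hq0 : q ≠ 0) (hq : ‖q‖ < 1) (hz : z ≠ 0) (N : ℕ) :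
    qPochN q q (2 * N) * finTheta q z N N = qPochN z q N * qPochN (q / z) q N := by
  induction N with
  | zero => simp [finTheta_zero, qPochN]
  | succ N ih =>
    have h1 := finTheta_left hq0 hq hz N N
    have h2 := finTheta_right hq0 hq hz (N + 1) N
    rw [show (N : ℤ) + N + 1 = (2 * N + 1 : ℕ) by push_cast; ring, zpow_natCast, pow_succ',
      zpow_natCast] at h1
    rw [show (N : ℤ) + 1 + N + 1 = (2 * N + 1 + 1 : ℕ) by push_cast; ring, zpow_natCast, pow_succ',
      zpow_natCast] at h2
    rw [show 2 * (N + 1) = 2 * N + 1 + 1 by ring, qPochN_succ, qPochN_succ, qPochN_succ,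
      qPochN_succ, Nat.cast_succ]
    linear_combination qPochN q q (2 * N) * (1 - q * q ^ (2 * N)) * h2 +
      qPochN q q (2 * N) * (1 - q / z * q ^ N) * h1 +
      (1 - z * q ^ N) * (1 - q / z * q ^ N) * ih

/-- The **Jacobi triple product** identity. -/
theorem tsum_thetaTerm {q z : ℂ} (hq0 : q ≠ 0) (hq : ‖q‖ < 1) (hz : z ≠ 0) :
    ∑' n : ℤ, thetaTerm q z n = qPochInf q q * (qPochInf z q * qPochInf (q / z) q) := by
  obtain ⟨C, hC⟩ := exists_norm_qInv_le hq
  have hC0 : 0 ≤ C := (norm_nonneg _).trans (hC 0)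
  have hlim : Tendsto (fun N : ℕ => finTheta q z N N) atTop
      (𝓝 (∑' n : ℤ, thetaTerm q z n * ((qPochInf q q)⁻¹ * (qPochInf q q)⁻¹))) := by
    refine tendsto_tsum_of_dominated_convergence
      (bound := fun n => ‖thetaTerm q z n‖ * (C * C))
      ((summable_thetaTerm hq0 hq hz).norm.mul_right _) (fun n => ?_)
      (Eventually.of_forall fun N n => ?_)
    · refine Tendsto.const_mul _ (Tendsto.mul ?_ ?_)
      · exact (tendsto_qInv hq).comp
          (tendsto_atTop_add_const_right _ (-n) tendsto_natCast_atTop_atTop)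
      · exact (tendsto_qInv hq).comp
          (tendsto_atTop_add_const_right _ n tendsto_natCast_atTop_atTop)
    · rw [norm_mul, norm_mul]
      gcongr
      · exact hC _
      · exact hC _
  have h2 : Tendsto (fun N : ℕ => qPochN q q (2 * N)) atTop (𝓝 (qPochInf q q)) :=
    (tendsto_qPochN q hq).comp (tendsto_id.const_mul_atTop' two_pos)
  have heq := tendsto_nhds_unique
    ((h2.mul hlim).congr (qPochN_mul_finTheta hq0 hq hz))
    ((tendsto_qPochN z hq).mul (tendsto_qPochN (q / z) hq))
  have hne := qPochInf_ne_zero hq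
  rw [tsum_mul_right] at heq
  rw [← heq]
  field_simp

/-- The series `∑ q^(j² + mj) y^j / ((q)_j (q)_{j+m})`, to be used with `y = 1` and `y = q`. -/
noncomputable def durfee (q y : ℂ) (m : ℕ) : ℂ :=
  ∑' j : ℕ, q ^ (j ^ 2 + m * j) * y ^ j * (qInv q j * qInv q (j + m))

lemma norm_durfee_term_le {q y : ℂ} (hq : ‖q‖ < 1) (hy : ‖y‖ ≤ 1) {C : ℝ}
    (hC : ∀ m, ‖qInv q m‖ ≤ C) (m j : ℕ) (a b : ℤ) :
    ‖q ^ (j ^ 2 + m * j) * y ^ j * (qInv q a * qInv q b)‖ ≤ ‖q‖ ^ j * (C * C) := by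
  have hC0 : 0 ≤ C := (norm_nonneg _).trans (hC 0)
  rw [norm_mul, norm_mul, norm_mul, norm_pow, norm_pow]
  have h1 : ‖q‖ ^ (j ^ 2 + m * j) ≤ ‖q‖ ^ j :=
    pow_le_pow_of_le_one (norm_nonneg q) hq.le (by nlinarith [Nat.le_self_pow two_ne_zero j])
  have h2 : ‖y‖ ^ j ≤ 1 := pow_le_one₀ (norm_nonneg y) hy
  have h3 : ‖q‖ ^ (j ^ 2 + m * j) * ‖y‖ ^ j ≤ ‖q‖ ^ j := by
    simpa using mul_le_mul h1 h2 (by positivity) (by positivity)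
  exact mul_le_mul h3 (mul_le_mul (hC a) (hC b) (norm_nonneg _) hC0) (by positivity)
    (by positivity)

lemma summable_durfee_term {q y : ℂ} (hq : ‖q‖ < 1) (hy : ‖y‖ ≤ 1) (m : ℕ) (a b : ℕ → ℤ) :
    Summable fun j : ℕ => q ^ (j ^ 2 + m * j) * y ^ j * (qInv q (a j) * qInv q (b j)) := by
  obtain ⟨C, hC⟩ := exists_norm_qInv_le hq
  exact Summable.of_norm_bounded
    ((summable_geometric_of_lt_one (norm_nonneg q) hq).mul_right (C * C))
    fun j => norm_durfee_term_le hq hy hC m j _ _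

lemma durfee_one_eq {q : ℂ} (hq : ‖q‖ < 1) (m : ℕ) :
    durfee q 1 m = durfee q q m + q ^ (m + 1) * durfee q q (m + 1) := by
  have hs1 := summable_durfee_term hq norm_one.le m (fun j => j) (fun j => j + m)
  have hsq := summable_durfee_term hq hq.le m (fun j => j) (fun j => j + m)
  rw [← sub_eq_iff_eq_add', durfee, durfee, ← hs1.tsum_sub hsq,
    (hs1.sub hsq).tsum_eq_zero_add, durfee, ← tsum_mul_left]
  simp only [pow_zero, sub_self, zero_add]
  refine tsum_congr fun j => ?_
  have h := one_sub_zpow_mul_qInv hq ((j + 1 : ℕ) : ℤ)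
  rw [zpow_natCast, show ((j + 1 : ℕ) : ℤ) - 1 = j by push_cast; ring] at h
  rw [one_pow, show ((j : ℤ) + ((m + 1 : ℕ) : ℤ)) = ((j + 1 : ℕ) : ℤ) + m by push_cast; ring, ← h]
  ring

lemma durfee_self_eq {q : ℂ} (hq : ‖q‖ < 1) (m : ℕ) :
    durfee q q m = durfee q 1 (m + 1) - q ^ (m + 1) * durfee q q (m + 1) := by
  have hs1 := summable_durfee_term hq norm_one.le (m + 1) (fun j => j) (fun j => j + (m + 1 : ℕ))
  have hsq := summable_durfee_term hq hq.le (m + 1) (fun j => j) (fun j => j + (m + 1 : ℕ))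
  rw [durfee, durfee, durfee, ← tsum_mul_left, ← hs1.tsum_sub (hsq.mul_left _)]
  refine tsum_congr fun j => ?_
  have h := one_sub_zpow_mul_qInv hq ((j + (m + 1) : ℕ) : ℤ)
  rw [zpow_natCast, show ((j + (m + 1) : ℕ) : ℤ) - 1 = j + m by push_cast; ring] at h
  rw [one_pow, show ((j : ℤ) + ((m + 1 : ℕ) : ℤ)) = ((j + (m + 1) : ℕ) : ℤ) by push_cast; ring, ← h]
  ring

lemma durfee_one {q : ℂ} (hq : ‖q‖ < 1) (m : ℕ) : durfee q 1 m = (qPochInf q q)⁻¹ := by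
  have hstep : ∀ m, durfee q 1 m = durfee q 1 (m + 1) := fun m => by
    rw [durfee_one_eq hq, durfee_self_eq hq]; ring
  have hconst : ∀ n, durfee q 1 n = durfee q 1 0 := fun n => by
    induction n with
    | zero => rfl
    | succ n ih => rw [← hstep, ih]
  obtain ⟨C, hC⟩ := exists_norm_qInv_le hq
  have hlim : Tendsto (durfee q 1) atTop
      (𝓝 (∑' j : ℕ, if j = 0 then (qPochInf q q)⁻¹ else 0)) := by
    refine tendsto_tsum_of_dominated_convergence (bound := fun j => ‖q‖ ^ j * (C * C))
      ((summable_geometric_of_lt_one (norm_nonneg q) hq).mul_right _) (fun j => ?_)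
      (Eventually.of_forall fun m j => norm_durfee_term_le hq (by simp) hC m j _ _)
    have hc : Tendsto (fun m : ℕ => qInv q (j + m)) atTop (𝓝 (qPochInf q q)⁻¹) :=
      (tendsto_qInv hq).comp (tendsto_atTop_add_const_left _ _ tendsto_natCast_atTop_atTop)
    rcases Nat.eq_zero_or_pos j with rfl | hj
    · simpa [qInv, qPochN] using hc
    · have hp : Tendsto (fun m : ℕ => q ^ (j ^ 2 + m * j)) atTop (𝓝 0) :=
        (tendsto_pow_atTop_nhds_zero_of_norm_lt_one hq).comp
          (tendsto_atTop_mono (fun m => by simp only [id]; nlinarith) tendsto_id)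
      simpa [hj.ne'] using hp.mul (hc.const_mul (qInv q j))
  rw [tsum_ite_eq] at hlim
  rw [hconst m]
  exact tendsto_nhds_unique (tendsto_const_nhds.congr fun n => (hconst n).symm) hlim

/-- The sum over all `N` of the coefficient attached to a fixed `n`. -/
lemma tsum_sq_mul_qInv {q : ℂ} (hq : ‖q‖ < 1) (n : ℤ) :
    ∑' N : ℕ, q ^ (N ^ 2) * (qInv q (N - n) * qInv q (N + n)) =
      q ^ (n ^ 2) * (qPochInf q q)⁻¹ := by
  wlog hn : 0 ≤ n generalizing n
  · have h := this (-n) (by lia)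
    rw [neg_sq] at h
    rw [← h]
    refine tsum_congr fun N => ?_
    rw [sub_neg_eq_add, ← sub_eq_add_neg, mul_comm (qInv q (N - n))]
  obtain ⟨m, rfl⟩ := Int.eq_ofNat_of_zero_le hn
  rw [← durfee_one hq (2 * m), durfee, ← tsum_mul_left]
  refine ((add_left_injective m).tsum_eq (fun N hN => ?_)).symm.trans (tsum_congr fun j => ?_)
  · refine ⟨N - m, Nat.sub_add_cancel (not_lt.mp fun h => hN ?_)⟩
    simp [qInv_of_neg q (show (N : ℤ) - m < 0 by lia)]
  · rw [show ((j + m : ℕ) : ℤ) - m = j by push_cast; ring,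
      show ((j + m : ℕ) : ℤ) + m = j + (2 * m : ℕ) by push_cast; ring,
      show ((m : ℤ) ^ 2) = (m ^ 2 : ℕ) by push_cast; ring, zpow_natCast]
    ring

/-- The summand `(-1)^n q^((k-1)n² + n(n+1)/2 + hn)` of the closed form for paths that start at
height `h`. -/
noncomputable def pathTerm (q : ℂ) (k h n : ℤ) : ℂ :=
  thetaTerm (q ^ (2 * k - 1)) (q ^ (k + h)) n

lemma pathTerm_sub_one {q : ℂ} (hq0 : q ≠ 0) (k h n : ℤ) :
    pathTerm q k h n = q ^ n * pathTerm q k (h - 1) n := by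
  rw [pathTerm, pathTerm, thetaTerm, thetaTerm, show k + h = 1 + (k + (h - 1)) by ring,
    zpow_add₀ hq0, zpow_one, mul_zpow]
  ring

lemma pathTerm_zero_neg {q : ℂ} (hq0 : q ≠ 0) (k n : ℤ) :
    pathTerm q k 0 (-n) = pathTerm q k (-1) n := by
  rw [pathTerm, pathTerm, thetaTerm_neg (zpow_ne_zero _ hq0), ← zpow_sub₀ hq0]
  congr 2
  ring

lemma pathTerm_reflect {q : ℂ} (hq0 : q ≠ 0) (k n : ℤ) :
    pathTerm q k (k - 1) (-1 - n) = -pathTerm q k (k - 1) n := by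
  have hQ : q ^ (2 * k - 1) ≠ 0 := zpow_ne_zero _ hq0
  rw [pathTerm, pathTerm, show k + (k - 1) = 2 * k - 1 by ring]
  generalize q ^ (2 * k - 1) = Q at *
  rw [show -1 - n = -(n + 1) by ring, thetaTerm_neg hQ, div_self hQ,
    thetaTerm_add_one hQ one_ne_zero, thetaTerm, thetaTerm, one_zpow]
  ring

/-- The closed form for the generating function of paths with `N` peaks from height `h`. -/
noncomputable def pathSum (q : ℂ) (k h N : ℤ) : ℂ :=
  q ^ (N ^ 2) * ∑' n : ℤ, pathTerm q k h n * (qInv q (N - n) * qInv q (N + n))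

/-- The closed form for the generating function of paths from height `h` which are preceded by a
North-East step and have `N` peaks together with that step. -/
noncomputable def riseSum (q : ℂ) (k h N : ℤ) : ℂ :=
  q ^ (N ^ 2 - N) * ∑' n : ℤ, pathTerm q k (h - 1) n * (qInv q (N - 1 - n) * qInv q (N + n))

lemma pathSum_eq {q : ℂ} (hq0 : q ≠ 0) (hq : ‖q‖ < 1) (k h N : ℤ) :
    pathSum q k h N = q ^ N * pathSum q k (h - 1) N + q ^ N * riseSum q k (h + 1) N := by
  have hpow : q ^ (N ^ 2) = q ^ N * q ^ (N ^ 2 - N) := by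
    rw [← zpow_add₀ hq0]; congr 1; ring
  have hsum : ∑' n : ℤ, pathTerm q k h n * (qInv q (N - n) * qInv q (N + n)) =
      q ^ N * ∑' n : ℤ, pathTerm q k (h - 1) n * (qInv q (N - n) * qInv q (N + n)) +
      ∑' n : ℤ, pathTerm q k h n * (qInv q (N - 1 - n) * qInv q (N + n)) := by
    rw [← tsum_mul_left, ← ((summable_mul_qInv q _ N N).mul_left _).tsum_add
      (summable_mul_qInv q _ (N - 1) N)]
    refine tsum_congr fun n => ?_
    have hN : q ^ n * q ^ (N - n) = q ^ N := by rw [← zpow_add₀ hq0]; congr 1; ring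
    rw [show N - 1 - n = N - n - 1 by ring, ← one_sub_zpow_mul_qInv hq (N - n),
      pathTerm_sub_one hq0, ← hN]
    ring
  rw [pathSum, hsum, pathSum, riseSum, add_sub_cancel_right, hpow]
  ring

lemma pathSum_zero_eq {q : ℂ} (hq0 : q ≠ 0) (hq : ‖q‖ < 1) (k N : ℤ) :
    (1 - q ^ N) * pathSum q k 0 N = q ^ N * riseSum q k 1 N := by
  have hneg : pathSum q k (0 - 1) N = pathSum q k 0 N := by
    rw [pathSum, pathSum, ← (Equiv.neg ℤ).tsum_eq
      fun n => pathTerm q k 0 n * (qInv q (N - n) * qInv q (N + n))]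
    congr 1
    refine tsum_congr fun n => ?_
    rw [Equiv.neg_apply, pathTerm_zero_neg hq0, sub_neg_eq_add, ← sub_eq_add_neg, zero_sub,
      mul_comm (qInv q (N - n))]
  have h := pathSum_eq hq0 hq k 0 N
  rw [hneg, zero_add] at h
  linear_combination h

lemma riseSum_eq {q : ℂ} (hq0 : q ≠ 0) (hq : ‖q‖ < 1) (k h N : ℤ) :
    riseSum q k h N = q ^ N * riseSum q k (h + 1) N + q ^ (N - 1) * pathSum q k (h - 1) (N - 1) := by
  have hpow : q ^ (N ^ 2 - N) = q ^ (N - 1) * q ^ ((N - 1) ^ 2) := by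
    rw [← zpow_add₀ hq0]; congr 1; ring
  have hsum : ∑' n : ℤ, pathTerm q k (h - 1) n * (qInv q (N - 1 - n) * qInv q (N + n)) =
      q ^ N * ∑' n : ℤ, pathTerm q k h n * (qInv q (N - 1 - n) * qInv q (N + n)) +
      ∑' n : ℤ, pathTerm q k (h - 1) n * (qInv q (N - 1 - n) * qInv q (N - 1 + n)) := by
    rw [← tsum_mul_left, ← ((summable_mul_qInv q _ (N - 1) N).mul_left _).tsum_add
      (summable_mul_qInv q _ (N - 1) (N - 1))]
    refine tsum_congr fun n => ?_
    rw [show N - 1 + n = N + n - 1 by ring, ← one_sub_zpow_mul_qInv hq (N + n),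
      pathTerm_sub_one hq0 k h, zpow_add₀ hq0]
    ring
  rw [riseSum, hsum, riseSum, pathSum, add_sub_cancel_right, hpow]
  ring

lemma riseSum_top {q : ℂ} (hq0 : q ≠ 0) (k N : ℤ) : riseSum q k k N = 0 := by
  have h : ∑' n : ℤ, pathTerm q k (k - 1) n * (qInv q (N - 1 - n) * qInv q (N + n)) =
      -∑' n : ℤ, pathTerm q k (k - 1) n * (qInv q (N - 1 - n) * qInv q (N + n)) := by
    conv_lhs => rw [← (Equiv.subLeft (-1 : ℤ)).tsum_eq]
    rw [← tsum_neg]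
    refine tsum_congr fun n => ?_
    rw [Equiv.subLeft_apply, pathTerm_reflect hq0, show N - 1 - (-1 - n) = N + n by ring,
      show N + (-1 - n) = N - 1 - n by ring]
    ring
  rw [riseSum, self_eq_neg.mp h, mul_zero]

lemma pathSum_no_peaks (q : ℂ) (k h : ℤ) : pathSum q k h 0 = 1 := by
  rw [pathSum, tsum_eq_single 0]
  · simp [pathTerm, thetaTerm, tri, qInv, qPochN]
  · intro n hn
    rcases lt_or_gt_of_ne hn with h | h
    · rw [qInv_of_neg q (show 0 + n < 0 by lia), mul_zero, mul_zero]
    · rw [qInv_of_neg q (show 0 - n < 0 by lia), zero_mul, mul_zero]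

lemma summable_pathSum_terms {q : ℂ} (hq0 : q ≠ 0) (hq : ‖q‖ < 1) {k : ℤ} (hk : 1 ≤ k) (h : ℤ) :
    Summable fun p : ℕ × ℤ =>
      pathTerm q k h p.2 * (q ^ (p.1 ^ 2) * (qInv q (p.1 - p.2) * qInv q (p.1 + p.2))) := by
  obtain ⟨C, hC⟩ := exists_norm_qInv_le hq
  have hC0 : 0 ≤ C := (norm_nonneg _).trans (hC 0)
  have hQ : ‖q ^ (2 * k - 1)‖ < 1 := by
    rw [norm_zpow]
    exact zpow_lt_one₀ (norm_pos_iff.mpr hq0) hq (by lia)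
  have hθ : Summable fun n : ℤ => ‖pathTerm q k h n‖ :=
    (summable_thetaTerm (zpow_ne_zero _ hq0) hQ (zpow_ne_zero _ hq0)).norm
  have hgeo := (summable_geometric_of_lt_one (norm_nonneg q) hq).mul_right (C * C)
  refine Summable.of_norm_bounded (hgeo.mul_of_nonneg hθ (fun _ => by positivity)
    fun _ => norm_nonneg _) fun p => ?_
  rw [norm_mul, mul_comm]
  gcongr
  rw [norm_mul, norm_mul, norm_pow]
  have h1 : ‖q‖ ^ (p.1 ^ 2) ≤ ‖q‖ ^ p.1 :=
    pow_le_pow_of_le_one (norm_nonneg q) hq.le (Nat.le_self_pow two_ne_zero _)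
  exact mul_le_mul h1 (mul_le_mul (hC _) (hC _) (norm_nonneg _) hC0) (by positivity) (by positivity)

lemma pathSum_natCast (q : ℂ) (k h : ℤ) (N : ℕ) :
    pathSum q k h N = ∑' n : ℤ,
      pathTerm q k h n * (q ^ (N ^ 2) * (qInv q (N - n) * qInv q (N + n))) := by
  rw [pathSum, ← tsum_mul_left]
  refine tsum_congr fun n => ?_
  rw [show ((N : ℤ) ^ 2) = ((N ^ 2 : ℕ) : ℤ) by push_cast; ring, zpow_natCast]
  ring

lemma summable_norm_pathSum {q : ℂ} (hq0 : q ≠ 0) (hq : ‖q‖ < 1) {k : ℤ} (hk : 1 ≤ k) (h : ℤ) :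
    Summable fun N : ℕ => ‖pathSum q k h N‖ := by
  simp only [pathSum_natCast]
  exact (summable_pathSum_terms hq0 hq hk h).prod.norm

lemma tsum_pathSum {q : ℂ} (hq0 : q ≠ 0) (hq : ‖q‖ < 1) {k : ℤ} (hk : 1 ≤ k) (h : ℤ) :
    ∑' N : ℕ, pathSum q k h N =
      (∑' n : ℤ, thetaTerm (q ^ (2 * k + 1)) (q ^ (k + h + 1)) n) * (qPochInf q q)⁻¹ := by
  have hcomm := Summable.tsum_comm (f := fun (N : ℕ) (n : ℤ) =>
    pathTerm q k h n * (q ^ (N ^ 2) * (qInv q (N - n) * qInv q (N + n))))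
    (summable_pathSum_terms hq0 hq hk h)
  simp only [pathSum_natCast]
  rw [← hcomm, ← tsum_mul_right]
  refine tsum_congr fun n => ?_
  rw [tsum_mul_left, tsum_sq_mul_qInv hq, pathTerm, thetaTerm, thetaTerm, ← zpow_mul, ← zpow_mul,
    ← zpow_mul, ← zpow_mul]
  have hexp : q ^ ((k + h) * n) * q ^ ((2 * k - 1) * tri n) * q ^ (n ^ 2) =
      q ^ ((k + h + 1) * n) * q ^ ((2 * k + 1) * tri n) := by
    rw [← zpow_add₀ hq0, ← zpow_add₀ hq0, ← zpow_add₀ hq0]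
    congr 1
    have := two_mul_tri n
    linear_combination this * (-1)
  linear_combination (-1) ^ n * (qPochInf q q)⁻¹ * hexp

/-- Recursive description of the paths without South steps which start at height `h` and stay
below height `k`. -/
def IsPath (k : ℕ) : ℕ → List PStep → Prop
  | h, [] => h = 0
  | h, .NE :: l => h + 1 < k ∧ IsPath k (h + 1) l
  | h, .SE :: l => 0 < h ∧ IsPath k (h - 1) l
  | h, .E :: l => h = 0 ∧ l ≠ [] ∧ IsPath k 0 l
  | _, .S :: _ => False

lemma isPeak_cons_succ (s : PStep) (l : List PStep) (m : ℕ) :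
    IsPeak (s :: l) (m + 1) ↔ IsPeak l m := by
  simp [IsPeak]

lemma numPeaks_cons (s : PStep) (l : List PStep) :
    numPeaks (s :: l) = (if IsPeak (s :: l) 0 then 1 else 0) + numPeaks l := by
  simp only [numPeaks, Finset.card_filter, List.length_cons]
  rw [Finset.sum_range_succ', add_comm]
  simp only [isPeak_cons_succ]

lemma majorIndex_cons {s : PStep} (hs : stepDx s = 1) (l : List PStep) :
    majorIndex (s :: l) = majorIndex l + numPeaks (s :: l) := by
  rw [numPeaks_cons, numPeaks, Finset.card_filter, majorIndex, List.length_cons,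
    Finset.sum_range_succ', majorIndex, ← add_assoc, add_right_comm, ← Finset.sum_add_distrib]
  congr 1
  · refine Finset.sum_congr rfl fun m _ => ?_
    simp only [isPeak_cons_succ]
    split_ifs
    · rw [List.take_succ_cons, pathX, List.map_cons, List.sum_cons, hs, add_comm, pathX]
    · rfl
  · simp [pathX, hs]

lemma numPeaks_nil : numPeaks [] = 0 := by simp [numPeaks]

lemma majorIndex_nil : majorIndex [] = 0 := by simp [majorIndex]

lemma numPeaks_SE_cons (l : List PStep) : numPeaks (.SE :: l) = numPeaks l := by
  simp [numPeaks_cons, IsPeak]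

lemma numPeaks_E_cons (l : List PStep) : numPeaks (.E :: l) = numPeaks l := by
  simp [numPeaks_cons, IsPeak]

lemma numPeaks_NE_NE_cons (l : List PStep) : numPeaks (.NE :: .NE :: l) = numPeaks (.NE :: l) := by
  rw [numPeaks_cons]
  simp [IsPeak]

lemma numPeaks_NE_SE_cons (l : List PStep) : numPeaks (.NE :: .SE :: l) = numPeaks l + 1 := by
  rw [numPeaks_cons, numPeaks_SE_cons]
  simp [IsPeak, add_comm]

lemma isPath_and_numPeaks_eq_zero {k h : ℕ} {l : List PStep} (hl : IsPath k h l)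
    (hp : numPeaks l = 0) : l = List.replicate h .SE := by
  induction l generalizing h with
  | nil => simp_all [IsPath]
  | cons s l ih =>
    have hpl : numPeaks l = 0 := by rw [numPeaks_cons] at hp; lia
    cases s with
    | NE =>
      rw [ih hl.2 hpl, List.replicate_succ, numPeaks_NE_SE_cons] at hp
      lia
    | SE =>
      obtain ⟨h, rfl⟩ := Nat.exists_eq_add_of_lt hl.1
      rw [ih hl.2 hpl]
      simp [List.replicate_succ]
    | S => exact hl.elim
    | E => exact absurd (ih hl.2.2 hpl) hl.2.1

lemma isPath_replicate (k h : ℕ) : IsPath k h (List.replicate h .SE) := by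
  induction h with
  | zero => rfl
  | succ h ih => exact ⟨Nat.succ_pos h, ih⟩

lemma stats_replicate (h : ℕ) :
    numPeaks (List.replicate h .SE) = 0 ∧ majorIndex (List.replicate h .SE) = 0 := by
  induction h with
  | zero => exact ⟨numPeaks_nil, majorIndex_nil⟩
  | succ h ih =>
    rw [List.replicate_succ, majorIndex_cons rfl, numPeaks_SE_cons, ih.1, ih.2]
    exact ⟨rfl, rfl⟩

instance : LawfulBEq PStep where
  eq_of_beq {a b} h := by cases a <;> cases b <;> first | rfl | exact absurd h (by decide)
  rfl {a} := by cases a <;> rfl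

/-- A valid path that stays below height `k` and has no South steps. -/
def BoundedPath (k h : ℕ) (l : List PStep) : Prop :=
  (ValidPath h l ∧ ∀ m : ℕ, pathHeight h (l.take m) < k) ∧ southSteps l = 0

lemma boundedPath_cons_iff {k h h' : ℕ} (hh : h < k) {s : PStep} (hs : s ≠ .S)
    (hdy : (h : ℤ) + stepDy s = h') (l : List PStep) :
    BoundedPath k h (s :: l) ↔
      (s = .E → h = 0) ∧ (l = [] → s = .SE) ∧ BoundedPath k h' l := by
  have hheight : ∀ l, pathHeight h (s :: l) = pathHeight h' l := fun l => by
    simp [pathHeight, ← hdy, add_assoc]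
  have hall : ∀ p : ℤ → Prop, (∀ m, p (pathHeight h ((s :: l).take m))) ↔
      p h ∧ ∀ m, p (pathHeight h' (l.take m)) := by
    intro p
    constructor
    · intro H
      exact ⟨by simpa [pathHeight] using H 0, fun m => by simpa [hheight] using H (m + 1)⟩
    · rintro ⟨h0, H⟩ (_ | m)
      · simpa [pathHeight] using h0
      · simpa [hheight] using H m
  have hE : (∀ m : ℕ, (s :: l)[m]? = some PStep.E → pathHeight h ((s :: l).take m) = 0) ↔
      (s = .E → h = 0) ∧ ∀ m : ℕ, l[m]? = some PStep.E → pathHeight h' (l.take m) = 0 := by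
    constructor
    · intro H
      exact ⟨fun hs => by simpa [pathHeight, hs] using H 0,
        fun m hm => by simpa [hheight, hm] using H (m + 1)⟩
    · rintro ⟨h0, H⟩ (_ | m)
      · simpa [pathHeight] using h0
      · simpa [hheight] using H m
  have hlast : (s :: l = [] ∨ (s :: l).getLast? = some PStep.SE ∨
      (s :: l).getLast? = some PStep.S) ↔ (l = [] → s = .SE) ∧
      (l = [] ∨ l.getLast? = some PStep.SE ∨ l.getLast? = some PStep.S) := by
    rcases l with _ | ⟨t, l⟩
    · simp [hs]
    · simp [List.getLast?_cons_cons]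
  have hcount : southSteps (s :: l) = 0 ↔ southSteps l = 0 := by
    simp [southSteps, hs]
  have hS : ∀ l : List PStep, southSteps l = 0 →
      ∀ m : ℕ, l[m]? = some PStep.S → ∃ m', m = m' + 1 ∧ l[m']? = some PStep.NE := by
    intro l hl m hm
    exact absurd (List.mem_of_getElem? hm) (List.count_eq_zero.mp hl)
  unfold BoundedPath ValidPath
  rw [hall (fun x => 0 ≤ x), hall (fun x => x < k), hE, hlast, hheight, hcount]
  have h1 := hS l
  have h2 := fun hl => hS (s :: l) (hcount.mpr hl)
  have h3 : (0 : ℤ) ≤ h ∧ (h : ℤ) < k := by lia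
  constructor
  · rintro ⟨⟨⟨⟨-, ha⟩, -, ⟨hE, hb⟩, hc, hl, hd⟩, -, he⟩, hf⟩
    exact ⟨hE, hl, ⟨⟨ha, h1 hf, hb, hc, hd⟩, he⟩, hf⟩
  · rintro ⟨hE, hl, ⟨⟨ha, -, hb, hc, hd⟩, he⟩, hf⟩
    exact ⟨⟨⟨⟨h3.1, ha⟩, h2 hf, ⟨hE, hb⟩, hc, hl, hd⟩, h3.2, he⟩, hf⟩

lemma boundedPath_iff_isPath {k h : ℕ} (hh : h < k) (l : List PStep) :
    BoundedPath k h l ↔ IsPath k h l := by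
  induction l generalizing h with
  | nil =>
    simp [BoundedPath, ValidPath, IsPath, pathHeight, southSteps]
    lia
  | cons s l ih =>
    have hlt : ∀ {h' : ℕ}, BoundedPath k h' l → h' < k := fun H => by
      simpa [pathHeight] using H.1.2 0
    cases s with
    | NE =>
      rw [boundedPath_cons_iff (h' := h + 1) hh (by simp) rfl, IsPath]
      constructor
      · rintro ⟨-, -, H⟩
        exact ⟨hlt H, (ih (hlt H)).mp H⟩
      · rintro ⟨hk, H⟩
        refine ⟨by simp, ?_, (ih hk).mpr H⟩
        rintro rfl
        simp [IsPath] at H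
    | SE =>
      rcases Nat.eq_zero_or_pos h with rfl | hpos
      · simp only [IsPath, lt_irrefl, false_and, iff_false]
        intro H
        have := H.1.1.1 1
        simp [pathHeight, stepDy] at this
      · rw [boundedPath_cons_iff (h' := h - 1) hh (by simp) (by simp [stepDy]; lia), IsPath,
          ih (by lia)]
        simp [hpos]
    | S =>
      simp [IsPath, BoundedPath, southSteps]
    | E =>
      rw [boundedPath_cons_iff (h' := h) hh (by simp) (by simp [stepDy]), IsPath, ih hh]
      constructor
      · rintro ⟨h0, h1, H⟩
        obtain rfl := h0 rfl
        exact ⟨rfl, fun hl => by simpa using h1 hl, H⟩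
      · rintro ⟨rfl, h1, H⟩
        exact ⟨fun _ => rfl, fun hl => absurd hl h1, H⟩

lemma hasSum_list {f : List PStep → ℂ} {a b c : ℂ} (ha : HasSum (fun l => f (.NE :: l)) a)
    (hb : HasSum (fun l => f (.SE :: l)) b) (hc : HasSum (fun l => f (.E :: l)) c)
    (hS : ∀ l, f (.S :: l) = 0) : HasSum f (f [] + a + b + c) := by
  have key : ∀ (s : PStep) (x : ℂ), HasSum (fun l => f (s :: l)) x →
      HasSum ((Set.range (List.cons s)).indicator f) x := fun s x hx =>
    hasSum_subtype_iff_indicator.mp ((List.cons_injective.hasSum_range_iff (f := f)).mpr hx)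
  have h0 : HasSum (fun l : List PStep => if l = [] then f [] else 0) (f []) := hasSum_ite_eq [] (f [])
  refine (((h0.add (key _ _ ha)).add (key _ _ hb)).add (key _ _ hc)).congr_fun fun l => ?_
  rcases l with _ | ⟨s, l⟩
  · simp [Set.indicator]
  · cases s <;> simp [Set.indicator, hS]

lemma hasSum_of_E_cons {f : List PStep → ℂ} {c S : ℂ} (hc : ‖c‖ < 1)
    (hE : ∀ l, f (.E :: l) = c * f l)
    (hS : HasSum ({l : List PStep | l.head? ≠ some .E}.indicator f) S) :
    HasSum f ((1 - c)⁻¹ * S) := by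
  set A : Set (List PStep) := {l | l.head? ≠ some .E} with hA
  rw [← hasSum_subtype_iff_indicator] at hS
  have hgeo := hasSum_geometric_of_norm_lt_one hc
  have hmul := hgeo.mul hS
    (summable_mul_of_summable_norm hgeo.summable.norm hS.summable.norm)
  let φ : ℕ × A → List PStep := fun p => List.replicate p.1 PStep.E ++ p.2.1
  have hinj : Function.Injective φ := by
    rintro ⟨m, l, hl⟩ ⟨n, l', hl'⟩ h
    simp only [φ] at h
    induction m generalizing n with
    | zero =>
      cases n with
      | zero => simpa using h
      | succ n =>
        refine absurd ?_ hl
        simp only [List.replicate_zero, List.nil_append] at h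
        simp [h, List.replicate_succ]
    | succ m ih =>
      cases n with
      | zero =>
        refine absurd ?_ hl'
        simp only [List.replicate_zero, List.nil_append] at h
        simp [← h, List.replicate_succ]
      | succ n =>
        have := ih n (by simpa [List.replicate_succ] using h)
        simp only [Prod.mk.injEq] at this ⊢
        exact ⟨by rw [this.1], this.2⟩
  have hsurj : Function.Surjective φ := by
    intro l
    induction l with
    | nil => exact ⟨(0, ⟨[], by simp [hA]⟩), rfl⟩
    | cons s l ih =>
      by_cases hs : s = .E
      · obtain ⟨⟨n, l'⟩, rfl⟩ := ih
        exact ⟨(n + 1, l'), by simp [φ, hs, List.replicate_succ]⟩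
      · exact ⟨(0, ⟨s :: l, by simpa [hA] using hs⟩), rfl⟩
  refine ((Equiv.ofBijective φ ⟨hinj, hsurj⟩).hasSum_iff).mp (hmul.congr_fun fun p => ?_)
  obtain ⟨n, l⟩ := p
  change f (List.replicate n PStep.E ++ l.1) = c ^ n * f l.1
  induction n with
  | zero => simp
  | succ n ih => rw [List.replicate_succ, List.cons_append, hE, ih, pow_succ']; ring

/-- The weight of a path with `N` peaks starting at height `h`. -/
noncomputable def pathWeight (q : ℂ) (k h N : ℕ) (l : List PStep) : ℂ :=
  if IsPath k h l ∧ numPeaks l = N then q ^ majorIndex l else 0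

/-- The weight of a path starting at height `h` and preceded by a North-East step. -/
noncomputable def riseWeight (q : ℂ) (k h N : ℕ) (l : List PStep) : ℂ :=
  if IsPath k h l ∧ numPeaks (.NE :: l) = N then q ^ majorIndex l else 0

lemma hasSum_riseWeight {q : ℂ} (hq0 : q ≠ 0) (hq : ‖q‖ < 1) {k N : ℕ}
    (hpath : ∀ h < k, HasSum (pathWeight q k h N) (pathSum q k h N)) (d : ℕ) :
    ∀ h, 0 < h → h + d + 1 = k →
      HasSum (riseWeight q k h (N + 1)) (riseSum q k h (N + 1 : ℕ)) := by
  have step : ∀ h, 0 < h → h < k → HasSum (fun l => riseWeight q k h (N + 1) (.NE :: l))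
      (q ^ (N + 1) * riseSum q k (h + 1) (N + 1 : ℕ)) →
      HasSum (riseWeight q k h (N + 1)) (riseSum q k h (N + 1 : ℕ)) := by
    intro h h0 hk hNE
    have hSE : HasSum (fun l => riseWeight q k h (N + 1) (.SE :: l))
        (q ^ N * pathSum q k (h - 1 : ℕ) N) := by
      refine ((hpath (h - 1) (by lia)).mul_left (q ^ N)).congr_fun fun l => ?_
      simp only [riseWeight, pathWeight, IsPath, h0, true_and, numPeaks_NE_SE_cons,
        Nat.add_right_cancel_iff, mul_ite, mul_zero]
      refine if_ctx_congr Iff.rfl (fun hl => ?_) fun _ => rfl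
      rw [majorIndex_cons rfl, numPeaks_SE_cons, hl.2, pow_add, mul_comm]
    have hE : HasSum (fun l => riseWeight q k h (N + 1) (.E :: l)) 0 := by
      refine hasSum_zero.congr_fun fun l => ?_
      simp [riseWeight, IsPath, h0.ne']
    have hsum := hasSum_list hNE hSE hE fun l => by simp [riseWeight, IsPath]
    convert hsum using 1
    rw [riseSum_eq hq0 hq]
    simp only [riseWeight, IsPath, h0.ne', false_and, if_false]
    rw [Nat.cast_sub h0, Nat.cast_add, Nat.cast_one, add_sub_cancel_right,
      zpow_natCast, zpow_add_one₀ hq0, zpow_natCast]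
    ring
  induction d with
  | zero =>
    intro h h0 hk
    refine step h h0 (by lia) ?_
    rw [show (h : ℤ) + 1 = k by lia, riseSum_top hq0, mul_zero]
    refine hasSum_zero.congr_fun fun l => ?_
    simp [riseWeight, IsPath, show ¬ h + 1 < k by lia]
  | succ d ih =>
    intro h h0 hk
    refine step h h0 (by lia) ?_
    refine ((ih (h + 1) (by lia) (by lia)).mul_left (q ^ (N + 1))).congr_fun fun l => ?_
    simp only [riseWeight, IsPath, show h + 1 < k by lia, true_and, numPeaks_NE_NE_cons, mul_ite,
      mul_zero]
    refine if_ctx_congr Iff.rfl (fun hl => ?_) fun _ => rfl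
    rw [majorIndex_cons rfl, hl.2, pow_add, mul_comm]

lemma hasSum_pathWeight_NE_cons {q : ℂ} (hq0 : q ≠ 0) {k h N : ℕ} (hk : h < k)
    (hrise : ∀ h, 0 < h → h < k → HasSum (riseWeight q k h N) (riseSum q k h N)) :
    HasSum (fun l => pathWeight q k h N (.NE :: l)) (q ^ N * riseSum q k (h + 1) N) := by
  rcases Nat.lt_or_ge (h + 1) k with hlt | hge
  · refine ((hrise (h + 1) (by lia) hlt).mul_left (q ^ N)).congr_fun fun l => ?_
    simp only [riseWeight, pathWeight, IsPath, hlt, true_and, mul_ite, mul_zero]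
    refine if_ctx_congr Iff.rfl (fun hl => ?_) fun _ => rfl
    rw [majorIndex_cons rfl, hl.2, pow_add, mul_comm]
  · rw [show (h : ℤ) + 1 = k by lia, riseSum_top hq0, mul_zero]
    refine hasSum_zero.congr_fun fun l => ?_
    simp [pathWeight, IsPath, hge.not_gt]

lemma hasSum_pathWeight_zero {q : ℂ} (k h : ℕ) :
    HasSum (pathWeight q k h 0) (pathSum q k h (0 : ℕ)) := by
  rw [Nat.cast_zero, pathSum_no_peaks]
  refine (hasSum_ite_eq (List.replicate h PStep.SE) (1 : ℂ)).congr_fun fun l => ?_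
  have hrep := stats_replicate h
  rw [pathWeight]
  by_cases hl : l = List.replicate h .SE
  · simp [hl, isPath_replicate, hrep.1, hrep.2]
  · rw [if_neg hl, if_neg fun H => hl (isPath_and_numPeaks_eq_zero H.1 H.2)]

lemma hasSum_pathWeight {q : ℂ} (hq0 : q ≠ 0) (hq : ‖q‖ < 1) (k N : ℕ) :
    ∀ h < k, HasSum (pathWeight q k h N) (pathSum q k h N) := by
  induction N with
  | zero => exact fun h _ => hasSum_pathWeight_zero k h
  | succ N ihN =>
    have hNE := fun {h : ℕ} (hk : h < k) => hasSum_pathWeight_NE_cons hq0 (N := N + 1) hk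
      fun h h0 hk => hasSum_riseWeight hq0 hq ihN (k - h - 1) h h0 (by lia)
    have hS : ∀ h l, pathWeight q k h (N + 1) (.S :: l) = 0 := fun h l => by
      simp [pathWeight, IsPath]
    have hnil : ∀ h, pathWeight q k h (N + 1) [] = 0 := fun h => by
      simp [pathWeight, numPeaks_nil]
    intro h
    induction h with
    | zero =>
      intro hk
      have hnorm : ‖q ^ (N + 1)‖ < 1 := by
        rw [norm_pow]; exact pow_lt_one₀ (norm_nonneg q) hq (Nat.succ_ne_zero N)
      have hEcons : ∀ l, pathWeight q k 0 (N + 1) (.E :: l) =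
          q ^ (N + 1) * pathWeight q k 0 (N + 1) l := by
        intro l
        simp only [pathWeight, IsPath, numPeaks_E_cons, true_and, mul_ite, mul_zero]
        refine if_ctx_congr ⟨fun H => ⟨H.1.2, H.2⟩, fun H => ⟨⟨?_, H.1⟩, H.2⟩⟩ (fun hl => ?_)
          fun _ => rfl
        · rintro rfl
          simp [numPeaks_nil] at H
        · rw [majorIndex_cons rfl, numPeaks_E_cons, hl.2, pow_add, mul_comm]
      have hind : HasSum ({l : List PStep | l.head? ≠ some .E}.indicator
          (pathWeight q k 0 (N + 1))) (q ^ (N + 1) * riseSum q k 1 (N + 1 : ℕ)) := by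
        have hsum := hasSum_list
          (f := {l : List PStep | l.head? ≠ some .E}.indicator (pathWeight q k 0 (N + 1)))
          (b := 0) (c := 0) ((hNE hk).congr_fun fun l => by simp [Set.indicator])
          (hasSum_zero.congr_fun fun l => by simp [Set.indicator, pathWeight, IsPath])
          (hasSum_zero.congr_fun fun l => by simp [Set.indicator])
          (fun l => by simp [Set.indicator, hS])
        simpa [Set.indicator, hnil] using hsum
      convert hasSum_of_E_cons hnorm hEcons hind using 1
      have hne : 1 - q ^ (N + 1) ≠ 0 := by
        rw [pow_succ']; exact one_sub_mul_pow_ne_zero hq N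
      have := pathSum_zero_eq hq0 hq k (N + 1 : ℕ)
      rw [zpow_natCast] at this
      rw [eq_inv_mul_iff_mul_eq₀ hne, Nat.cast_zero, this]
    | succ h ih =>
      intro hk
      have hSE : HasSum (fun l => pathWeight q k (h + 1) (N + 1) (.SE :: l))
          (q ^ (N + 1) * pathSum q k h (N + 1 : ℕ)) := by
        refine ((ih (by lia)).mul_left (q ^ (N + 1))).congr_fun fun l => ?_
        simp only [pathWeight, IsPath, Nat.succ_pos, true_and, numPeaks_SE_cons,
          Nat.add_sub_cancel, mul_ite, mul_zero]
        refine if_ctx_congr Iff.rfl (fun hl => ?_) fun _ => rfl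
        rw [majorIndex_cons rfl, numPeaks_SE_cons, hl.2, pow_add, mul_comm]
      have hE : HasSum (fun l => pathWeight q k (h + 1) (N + 1) (.E :: l)) 0 := by
        refine hasSum_zero.congr_fun fun l => ?_
        simp [pathWeight, IsPath]
      convert hasSum_list (hNE hk) hSE hE (hS _) using 1
      rw [pathSum_eq hq0 hq, hnil, Nat.cast_add h 1, Nat.cast_one, add_sub_cancel_right,
        zpow_natCast]
      ring

lemma summable_pow_majorIndex {q : ℂ} (hq0 : q ≠ 0) (hq : ‖q‖ < 1) {k h : ℕ} (hk : h < k) :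
    Summable fun l : {l // IsPath k h l} => q ^ majorIndex l.1 := by
  rw [← summable_norm_iff]
  simp only [norm_pow]
  set r := ‖q‖ with hr
  have hr0 : (r : ℂ) ≠ 0 := by simpa [hr] using hq0
  have hr1 : ‖(r : ℂ)‖ < 1 := by simpa [hr] using hq
  have hW := fun N => hasSum_pathWeight hr0 hr1 k N h hk
  let g : ℕ × List PStep → ℝ := fun p => ‖pathWeight r k h p.1 p.2‖
  have hval : ∀ N l, pathWeight r k h N l = ((‖pathWeight r k h N l‖ : ℝ) : ℂ) := by
    intro N l
    rw [pathWeight]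
    split_ifs <;> simp [hr]
  have hg : Summable g := by
    refine (summable_prod_of_nonneg fun p => norm_nonneg _).mpr
      ⟨fun N => (hW N).summable.norm, ?_⟩
    refine (summable_norm_pathSum hr0 hr1 (by lia : (1 : ℤ) ≤ k) h).congr fun N => ?_
    rw [← (hW N).tsum_eq, tsum_congr (hval N), ← Complex.ofReal_tsum, Complex.norm_real,
      Real.norm_of_nonneg (tsum_nonneg fun _ => norm_nonneg _)]
  let ι : {l // IsPath k h l} → ℕ × List PStep := fun l => (numPeaks l.1, l.1)
  have hι : Function.Injective ι := fun a b hab => Subtype.ext (Prod.ext_iff.mp hab).2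
  refine (hg.comp_injective hι).congr fun l => ?_
  simp [g, ι, pathWeight, l.2, hr]

lemma tsum_pow_majorIndex {q : ℂ} (hq0 : q ≠ 0) (hq : ‖q‖ < 1) {k h : ℕ} (hk : h < k) :
    ∑' l : {l // IsPath k h l}, q ^ majorIndex l.1 = ∑' N : ℕ, pathSum q k h N := by
  have hs := (summable_pow_majorIndex hq0 hq hk).hasSum
  rw [← (hs.tsum_fiberwise fun l => numPeaks l.1).tsum_eq]
  refine tsum_congr fun N => ?_
  rw [← (hasSum_pathWeight hq0 hq k N h hk).tsum_eq]
  let ι : ((fun l : {l // IsPath k h l} => numPeaks l.1) ⁻¹' {N}) → List PStep := fun l => l.1.1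
  have hι : Function.Injective ι := fun a b hab => Subtype.ext (Subtype.ext hab)
  rw [← hι.tsum_eq (f := pathWeight q k h N)]
  · refine tsum_congr fun l => ?_
    rw [pathWeight, if_pos ⟨l.1.2, l.2⟩]
  · intro l hl
    by_cases H : IsPath k h l ∧ numPeaks l = N
    · exact ⟨⟨⟨l, H.1⟩, H.2⟩, rfl⟩
    · exact absurd (if_neg H) hl

lemma tsum_Ebar {q : ℂ} (hq0 : q ≠ 0) (hq : ‖q‖ < 1) {k i : ℕ} (hi : 1 ≤ i) (hik : i ≤ k) :
    ∑' n : ℕ, (Ebar k i n 0 : ℂ) * q ^ n =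
      ∑' l : {l // IsPath k (k - i) l}, q ^ majorIndex l.1 := by
  have hk : k - i < k := by lia
  have hs := (summable_pow_majorIndex hq0 hq hk).hasSum
  rw [← (hs.tsum_fiberwise fun l => majorIndex l.1).tsum_eq]
  refine tsum_congr fun n => ?_
  have hcard : Ebar k i n 0 =
      Nat.card ((fun l : {l // IsPath k (k - i) l} => majorIndex l.1) ⁻¹' {n}) := by
    refine Nat.card_congr ((Equiv.subtypeEquivRight fun l => ?_).trans
      (Equiv.subtypeSubtypeEquivSubtypeInter _ fun l => majorIndex l = n).symm)
    rw [← boundedPath_iff_isPath hk, BoundedPath, SpecialPath]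
    tauto
  have hconst : ∀ l : (fun l : {l // IsPath k (k - i) l} => majorIndex l.1) ⁻¹' {n},
      q ^ majorIndex l.1.1 = q ^ n := fun l => by
    rw [show majorIndex l.1.1 = n from l.2]
  rw [tsum_congr hconst, tsum_const, hcard, nsmul_eq_mul]

/-- **Corollary 1.6, equation (1.3) (Andrews–Gordon).** For `k ≥ i ≥ 1` and `0 < |q| < 1`,
`Σ_n Ē_{k,i}(n,0) qⁿ = (qⁱ, q^{2k+1-i}, q^{2k+1}; q^{2k+1})_∞ / (q;q)_∞`. -/
theorem gen_fun_E_a_zero (k i : ℕ) (hi : 1 ≤ i) (hik : i ≤ k) (q : ℂ)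
    (hq0 : 0 < ‖q‖) (hq1 : ‖q‖ < 1) :
    ∑' n : ℕ, (Ebar k i n 0 : ℂ) * q ^ n =
      qPochInf (q ^ i) (q ^ (2 * k + 1)) * qPochInf (q ^ (2 * k + 1 - i)) (q ^ (2 * k + 1)) *
        qPochInf (q ^ (2 * k + 1)) (q ^ (2 * k + 1)) / qPochInf q q := by

  have hq : q ≠ 0 := norm_pos_iff.mp hq0
  have hQ : q ^ (2 * k + 1) ≠ 0 := pow_ne_zero _ hq
  have hQ1 : ‖q ^ (2 * k + 1)‖ < 1 := by
    rw [norm_pow]; exact pow_lt_one₀ (norm_nonneg q) hq1 (Nat.succ_ne_zero _)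
  have hbase : q ^ (2 * (k : ℤ) + 1) = q ^ (2 * k + 1) := by
    rw [← zpow_natCast]; push_cast; rfl
  have harg : q ^ ((k : ℤ) + (k - i : ℕ) + 1) = q ^ (2 * k + 1 - i) := by
    rw [← zpow_natCast]; congr 1; lia
  have hdiv : q ^ (2 * k + 1) / q ^ (2 * k + 1 - i) = q ^ i := by
    rw [div_eq_iff (pow_ne_zero _ hq), ← pow_add]; congr 1; lia
  rw [tsum_Ebar hq hq1 hi hik, tsum_pow_majorIndex hq hq1 (by lia),
    tsum_pathSum hq hq1 (by lia), hbase, harg, tsum_thetaTerm hQ hQ1 (pow_ne_zero _ hq), hdiv]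
  ring

end Paper
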